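/- Identity for the fractional spatial covariance: for any H ∈ (0,1) and x, y ∈ ℝ, c_H ∫_ℝ ℱ1_{[0,x]}(ξ) · conj(ℱ1_{[0,y]}(ξ)) · |ξ|^{1−2H} dξ = (1/2)(|x|^{2H} + |y|^{2H} − |x−y|^{2H}), where c_H = Γ(2H+1)sin(πH)/(2π). -/

import Mathlib

open MeasureTheory Real Complex

lemma setIntegral_Ioi_swap_of_nonneg {F : ℝ → ℝ → ℝ} {g h : ℝ → ℝ}
    (hF : Measurable (Function.uncurry F))
    (hF0 : ∀ u > 0, ∀ t > 0, 0 ≤ F u t)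
    (hg : ∀ u > 0, ∫ t in Set.Ioi 0, F u t = g u)
    (hFi : ∀ t > 0, IntegrableOn (fun u => F u t) (Set.Ioi 0))
    (hh : ∀ t > 0, ∫ u in Set.Ioi 0, F u t = h t)
    (hi : IntegrableOn h (Set.Ioi 0)) :
    IntegrableOn g (Set.Ioi 0) ∧ ∫ u in Set.Ioi 0, g u = ∫ t in Set.Ioi 0, h t := by
  have hprod : Integrable (Function.uncurry F)
      ((volume.restrict (Set.Ioi 0)).prod (volume.restrict (Set.Ioi 0))) := by
    rw [integrable_prod_iff' hF.aestronglyMeasurable]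
    refine ⟨?_, ?_⟩
    · filter_upwards [ae_restrict_mem measurableSet_Ioi] with t ht using hFi t ht
    · refine hi.congr ?_
      filter_upwards [ae_restrict_mem measurableSet_Ioi] with t ht
      rw [← hh t ht]
      refine setIntegral_congr_fun measurableSet_Ioi fun u hu => ?_
      simp [abs_of_nonneg (hF0 u hu t ht)]
  constructor
  · refine hprod.integral_prod_left.congr ?_
    filter_upwards [ae_restrict_mem measurableSet_Ioi] with u hu using hg u hu
  · rw [← setIntegral_congr_fun measurableSet_Ioi (fun u hu => hg u hu),
      ← setIntegral_congr_fun measurableSet_Ioi (fun t ht => hh t ht)]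
    exact integral_integral_swap hprod

lemma integrableOn_and_integral_one_sub_cos_mul_exp_neg {t : ℝ} (ht : 0 < t) :
    IntegrableOn (fun u : ℝ => (1 - Real.cos u) * Real.exp (-t * u)) (Set.Ioi 0) ∧
      ∫ u in Set.Ioi (0 : ℝ), (1 - Real.cos u) * Real.exp (-t * u) = 1 / (t * (1 + t ^ 2)) := by
  have hre : ((-t : ℂ) + Complex.I).re < 0 := by simpa using ht
  have h1 := integrableOn_exp_mul_Ioi (neg_lt_zero.mpr ht) 0
  have h2 := integrableOn_exp_mul_complex_Ioi hre 0
  have e2 : (fun u : ℝ => Real.cos u * Real.exp (-t * u)) =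
      fun u : ℝ => RCLike.re (Complex.exp (((-t : ℂ) + Complex.I) * u)) := by
    ext u
    simp [Complex.exp_re, mul_comm]
  have h2' : IntegrableOn (fun u : ℝ => Real.cos u * Real.exp (-t * u)) (Set.Ioi 0) := by
    rw [e2]; exact h2.re
  have h3 : ∫ u in Set.Ioi (0 : ℝ), Real.cos u * Real.exp (-t * u) = t / (1 + t ^ 2) := by
    rw [e2, integral_re h2, integral_exp_mul_complex_Ioi hre]
    simp [Complex.div_re, Complex.normSq_apply]
    ring_nf
  simp_rw [sub_mul, one_mul]
  refine ⟨h1.sub h2', ?_⟩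
  rw [integral_sub h1 h2', h3, integral_exp_mul_Ioi (neg_lt_zero.mpr ht)]
  field_simp
  simp

lemma integrableOn_and_integral_rpow_mul_exp_neg_mul {a r : ℝ} (ha : 0 < a) (hr : 0 < r) :
    IntegrableOn (fun t : ℝ => t ^ (a - 1) * Real.exp (-(r * t))) (Set.Ioi 0) ∧
      ∫ t in Set.Ioi (0 : ℝ), t ^ (a - 1) * Real.exp (-(r * t)) = r ^ (-a) * Real.Gamma a := by
  constructor
  · have := integrableOn_rpow_mul_exp_neg_mul_rpow (s := a - 1) (p := 1) (by linarith) one_pos hr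
    simpa using this
  · rw [Real.integral_rpow_mul_exp_neg_mul_Ioi ha hr, one_div, Real.inv_rpow hr.le,
      Real.rpow_neg hr.le]

lemma integrableOn_and_integral_rpow_div_one_add_sq {s : ℝ} (hs : 0 < s) (hs2 : s < 2) :
    IntegrableOn (fun t : ℝ => t ^ (s - 1) / (1 + t ^ 2)) (Set.Ioi 0) ∧
      ∫ t in Set.Ioi (0 : ℝ), t ^ (s - 1) / (1 + t ^ 2) = π / (2 * Real.sin (π * (s / 2))) := by
  obtain ⟨hi, hv⟩ := integrableOn_and_integral_rpow_mul_exp_neg_mul (a := 1 - s / 2) (r := 1)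
    (by linarith) one_pos
  have key := setIntegral_Ioi_swap_of_nonneg
    (F := fun t v => t ^ (s - 1) * Real.exp (-(v * (1 + t ^ 2))))
    (g := fun t => t ^ (s - 1) / (1 + t ^ 2))
    (h := fun v => Real.Gamma (s / 2) / 2 * (v ^ (1 - s / 2 - 1) * Real.exp (-(1 * v))))
    (by unfold Function.uncurry; fun_prop)
    (fun t ht v _ => mul_nonneg (Real.rpow_nonneg ht.le _) (Real.exp_nonneg _))
    (fun t _ => by
      have h := integral_exp_mul_Ioi (a := -(1 + t ^ 2)) (by nlinarith) 0
      have e : (fun v : ℝ => Real.exp (-(v * (1 + t ^ 2)))) =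
        fun v : ℝ => Real.exp (-(1 + t ^ 2) * v) := by ext v; ring_nf
      rw [integral_const_mul, e, h]
      simp [div_eq_mul_inv, ← inv_neg])
    (fun v hv => by
      have := (integrableOn_rpow_mul_exp_neg_mul_sq hv (s := s - 1) (by linarith)).mul_const
        (Real.exp (-v))
      refine IntegrableOn.congr_fun this (fun t _ => ?_) measurableSet_Ioi
      simp only [mul_assoc, ← Real.exp_add]
      ring_nf)
    (fun v hv => by
      have h := integral_rpow_mul_exp_neg_mul_rpow (p := 2) (q := s - 1) two_pos (by linarith) hv
      have e : ∀ t : ℝ, t ^ (s - 1) * Real.exp (-(v * (1 + t ^ 2))) =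
          Real.exp (-v) * (t ^ (s - 1) * Real.exp (-v * t ^ (2 : ℝ))) := by
        intro t
        rw [mul_left_comm, ← Real.exp_add, Real.rpow_two]
        ring_nf
      simp_rw [e]
      rw [integral_const_mul, h]
      ring_nf)
    (hi.const_mul _)
  refine ⟨key.1, key.2.trans ?_⟩
  rw [integral_const_mul, hv, Real.one_rpow, one_mul, div_mul_eq_mul_div,
    Real.Gamma_mul_Gamma_one_sub, div_div, mul_comm 2]

lemma integrableOn_and_integral_one_sub_cos_mul_rpow {s : ℝ} (hs : 0 < s) (hs2 : s < 2) :
    IntegrableOn (fun u : ℝ => (1 - Real.cos u) * u ^ (-1 - s)) (Set.Ioi 0) ∧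
      ∫ u in Set.Ioi (0 : ℝ), (1 - Real.cos u) * u ^ (-1 - s) =
        π / (2 * (Real.Gamma (s + 1) * Real.sin (π * (s / 2)))) := by
  obtain ⟨hi, hv⟩ := integrableOn_and_integral_rpow_div_one_add_sq hs hs2
  have hG : 0 < Real.Gamma (s + 1) := Real.Gamma_pos_of_pos (by linarith)
  have key := setIntegral_Ioi_swap_of_nonneg
    (F := fun u t => (Real.Gamma (s + 1))⁻¹ * t ^ s * ((1 - Real.cos u) * Real.exp (-t * u)))
    (g := fun u => (1 - Real.cos u) * u ^ (-1 - s))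
    (h := fun t => (Real.Gamma (s + 1))⁻¹ * (t ^ (s - 1) / (1 + t ^ 2)))
    (by unfold Function.uncurry; fun_prop)
    (fun u _ t ht => by
      have := sub_nonneg.mpr (Real.cos_le_one u)
      have := Real.rpow_nonneg ht.le s
      positivity)
    (fun u hu => by
      have h := (integrableOn_and_integral_rpow_mul_exp_neg_mul (a := s + 1) (by linarith) hu).2
      have e : ∀ t : ℝ, (Real.Gamma (s + 1))⁻¹ * t ^ s * ((1 - Real.cos u) * Real.exp (-t * u)) =
          (Real.Gamma (s + 1))⁻¹ * (1 - Real.cos u) *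
            (t ^ (s + 1 - 1) * Real.exp (-(u * t))) := by
        intro t
        ring_nf
      simp_rw [e]
      rw [integral_const_mul, h, show -(s + 1) = -1 - s by ring]
      field_simp)
    (fun t ht => (integrableOn_and_integral_one_sub_cos_mul_exp_neg ht).1.const_mul _)
    (fun t ht => by
      rw [integral_const_mul, (integrableOn_and_integral_one_sub_cos_mul_exp_neg ht).2,
        Real.rpow_sub_one ht.ne']
      field_simp)
    (hi.const_mul _)
  refine ⟨key.1, key.2.trans ?_⟩
  rw [integral_const_mul, hv]
  field_simp

lemma integrable_and_integral_one_sub_cos_mul_abs_rpow {s : ℝ} (hs : 0 < s) (hs2 : s < 2) (x : ℝ) :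
    Integrable (fun ξ : ℝ => (1 - Real.cos (x * ξ)) * |ξ| ^ (-1 - s)) ∧
      ∫ ξ : ℝ, (1 - Real.cos (x * ξ)) * |ξ| ^ (-1 - s) =
        |x| ^ s * (π / (Real.Gamma (s + 1) * Real.sin (π * (s / 2)))) := by
  rcases eq_or_ne x 0 with rfl | hx
  · simp [Real.zero_rpow hs.ne']
  have hx' : 0 < |x| := abs_pos.mpr hx
  have hG : 0 < Real.Gamma (s + 1) := Real.Gamma_pos_of_pos (by linarith)
  have hsin : 0 < Real.sin (π * (s / 2)) :=
    Real.sin_pos_of_pos_of_lt_pi (by positivity) (by nlinarith [Real.pi_pos])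
  have hval : ∫ ξ : ℝ, (1 - Real.cos (x * ξ)) * |ξ| ^ (-1 - s) =
      |x| ^ s * (π / (Real.Gamma (s + 1) * Real.sin (π * (s / 2)))) := by
    have e : ∀ ξ : ℝ, (1 - Real.cos (x * ξ)) * |ξ| ^ (-1 - s) =
        (fun r : ℝ => (1 - Real.cos (|x| * r)) * r ^ (-1 - s)) |ξ| := by
      intro ξ
      simp only
      rw [← abs_mul, Real.cos_abs]
    have e' : ∀ r ∈ Set.Ioi (0 : ℝ), (1 - Real.cos (|x| * r)) * r ^ (-1 - s) =
        |x| ^ (1 + s) * ((1 - Real.cos (|x| * r)) * (|x| * r) ^ (-1 - s)) := by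
      intro r hr
      rw [Real.mul_rpow hx'.le (le_of_lt hr), mul_left_comm, ← mul_assoc (|x| ^ (1 + s)),
        ← Real.rpow_add hx']
      simp
    rw [integral_congr_ae (.of_forall e),
      integral_comp_abs (f := fun r : ℝ => (1 - Real.cos (|x| * r)) * r ^ (-1 - s)),
      setIntegral_congr_fun measurableSet_Ioi e', integral_const_mul,
      integral_comp_mul_left_Ioi (fun u => (1 - Real.cos u) * u ^ (-1 - s)) 0 hx', mul_zero,
      (integrableOn_and_integral_one_sub_cos_mul_rpow hs hs2).2, Real.rpow_add hx', Real.rpow_one,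
      smul_eq_mul]
    field_simp
  refine ⟨?_, hval⟩
  by_contra hni
  rw [integral_undef hni] at hval
  have : 0 < |x| ^ s * (π / (Real.Gamma (s + 1) * Real.sin (π * (s / 2)))) := by positivity
  exact this.ne hval

lemma exp_neg_I_mul_sub_one (ξ x : ℝ) :
    Complex.exp (-Complex.I * ξ * x) - 1 =
      ⟨Real.cos (x * ξ) - 1, -Real.sin (x * ξ)⟩ := by
  have : -Complex.I * ξ * x = ((-(x * ξ) : ℝ) : ℂ) * Complex.I := by push_cast; ring
  rw [this]
  apply Complex.ext
  · rw [Complex.sub_re, Complex.exp_ofReal_mul_I_re, Real.cos_neg, Complex.one_re]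
  · rw [Complex.sub_im, Complex.exp_ofReal_mul_I_im, Real.sin_neg, Complex.one_im, sub_zero]

lemma norm_exp_neg_I_mul_sub_one_sq (ξ x : ℝ) :
    ‖Complex.exp (-Complex.I * ξ * x) - 1‖ ^ 2 = 2 * (1 - Real.cos (x * ξ)) := by
  rw [exp_neg_I_mul_sub_one, Complex.sq_norm, Complex.normSq_mk]
  nlinarith [Real.sin_sq_add_cos_sq (x * ξ)]

lemma fourier_indicator_mul_conj_mul_rpow (s x y ξ : ℝ) :
    ((Complex.exp (-Complex.I * ξ * x) - 1) / (-Complex.I * ξ)) *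
        (starRingEnd ℂ) ((Complex.exp (-Complex.I * ξ * y) - 1) / (-Complex.I * ξ)) *
        ((|ξ| ^ (1 - s) : ℝ) : ℂ) =
      (Complex.exp (-Complex.I * ξ * x) - 1) *
        (starRingEnd ℂ) (Complex.exp (-Complex.I * ξ * y) - 1) * ((|ξ| ^ (-1 - s) : ℝ) : ℂ) := by
  rcases eq_or_ne ξ 0 with rfl | hξ
  · simp
  have hp : |ξ| ^ (1 - s) = ξ ^ 2 * |ξ| ^ (-1 - s) := by
    rw [← sq_abs ξ, ← Real.rpow_two, ← Real.rpow_add (abs_pos.mpr hξ)]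
    ring_nf
  have hξ' : (ξ : ℂ) ≠ 0 := by exact_mod_cast hξ
  rw [hp, map_div₀, map_mul, map_neg, Complex.conj_I, Complex.conj_ofReal, neg_neg, div_mul_div_comm]
  have : -Complex.I * ξ * (Complex.I * ξ) = ((ξ ^ 2 : ℝ) : ℂ) := by
    push_cast
    linear_combination (-(ξ : ℂ) ^ 2) * Complex.I_mul_I
  rw [this]
  push_cast
  field_simp

theorem fbm_spatial_covariance (H : ℝ) (hH : H ∈ Set.Ioo (0 : ℝ) 1) (x y : ℝ) :
    ((Real.Gamma (2 * H + 1) * Real.sin (π * H) / (2 * π) : ℝ) : ℂ) *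
      ∫ ξ : ℝ,
        ((Complex.exp (-Complex.I * ξ * x) - 1) / (-Complex.I * ξ)) *
          (starRingEnd ℂ) ((Complex.exp (-Complex.I * ξ * y) - 1) / (-Complex.I * ξ)) *
          ((|ξ| ^ (1 - 2 * H) : ℝ) : ℂ)
      = (((|x| ^ (2 * H) + |y| ^ (2 * H) - |x - y| ^ (2 * H)) / 2 : ℝ) : ℂ) := by
  obtain ⟨h0, h1⟩ := hH
  have hK := integrable_and_integral_one_sub_cos_mul_abs_rpow (s := 2 * H) (by linarith)
    (by linarith)
  simp_rw [fourier_indicator_mul_conj_mul_rpow]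
  set f : ℝ → ℂ := fun ξ => (Complex.exp (-Complex.I * ξ * x) - 1) *
    (starRingEnd ℂ) (Complex.exp (-Complex.I * ξ * y) - 1) *
      ((|ξ| ^ (-1 - 2 * H) : ℝ) : ℂ) with hf
  have hfm : Measurable f := by
    have hE : ∀ z : ℝ, Measurable fun ξ : ℝ => Complex.exp (-Complex.I * ξ * z) - 1 :=
      fun z => Continuous.measurable (by fun_prop)
    have hP : Measurable fun ξ : ℝ => |ξ| ^ (-1 - 2 * H) := by fun_prop
    exact ((hE x).mul (Complex.continuous_conj.measurable.comp (hE y))).mul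
      (Complex.measurable_ofReal.comp hP)
  have hfi : Integrable f := by
    refine ((hK x).1.add (hK y).1).mono' hfm.aestronglyMeasurable (.of_forall fun ξ => ?_)
    have hr : 0 ≤ |ξ| ^ (-1 - 2 * H) := by positivity
    rw [Pi.add_apply, ← add_mul, hf, norm_mul, norm_mul, RCLike.norm_conj, Complex.norm_real,
      Real.norm_of_nonneg hr]
    refine mul_le_mul_of_nonneg_right ?_ hr
    have := two_mul_le_add_sq ‖Complex.exp (-Complex.I * ξ * x) - 1‖
      ‖Complex.exp (-Complex.I * ξ * y) - 1‖
    rw [norm_exp_neg_I_mul_sub_one_sq, norm_exp_neg_I_mul_sub_one_sq] at this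
    linarith
  have hre : ∀ ξ, (f ξ).re = (1 - Real.cos (x * ξ)) * |ξ| ^ (-1 - 2 * H) +
      (1 - Real.cos (y * ξ)) * |ξ| ^ (-1 - 2 * H) -
      (1 - Real.cos ((x - y) * ξ)) * |ξ| ^ (-1 - 2 * H) := by
    intro ξ
    rw [hf, Complex.re_mul_ofReal, exp_neg_I_mul_sub_one, exp_neg_I_mul_sub_one, Complex.mul_re,
      Complex.conj_re, Complex.conj_im, sub_mul x y ξ, Real.cos_sub]
    ring
  have hconj : (starRingEnd ℂ) (∫ ξ, f ξ) = ∫ ξ, f ξ := by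
    rw [← integral_conj, ← integral_neg_eq_self]
    refine integral_congr_ae (.of_forall fun ξ => ?_)
    simp only [hf, map_mul, map_sub, map_one, Complex.conj_ofReal, ← Complex.exp_conj, map_neg,
      Complex.conj_I, abs_neg, Complex.ofReal_neg, neg_neg, mul_neg, neg_mul]
  have hint : (∫ ξ, f ξ).re = (|x| ^ (2 * H) + |y| ^ (2 * H) - |x - y| ^ (2 * H)) *
      (π / (Real.Gamma (2 * H + 1) * Real.sin (π * H))) := by
    have h := integral_re hfi
    have hadd : Integrable fun ξ : ℝ => (1 - Real.cos (x * ξ)) * |ξ| ^ (-1 - 2 * H) +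
      (1 - Real.cos (y * ξ)) * |ξ| ^ (-1 - 2 * H) := (hK x).1.add (hK y).1
    simp only [RCLike.re_to_complex] at h
    rw [← h]
    rw [integral_congr_ae (.of_forall hre),
      integral_sub hadd (hK (x - y)).1, integral_add (hK x).1 (hK y).1,
      (hK x).2, (hK y).2, (hK (x - y)).2, mul_div_cancel_left₀ H two_ne_zero]
    ring
  rw [← Complex.conj_eq_iff_re.mp hconj, hint, ← Complex.ofReal_mul]
  have hG : 0 < Real.Gamma (2 * H + 1) := Real.Gamma_pos_of_pos (by linarith)
  have hsin : 0 < Real.sin (π * H) :=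
    Real.sin_pos_of_pos_of_lt_pi (by positivity) (by nlinarith [Real.pi_pos])
  congr 1
  generalize Real.sin (π * H) = σ at hsin ⊢
  field_simp
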